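/- Fix b ∈ (0,3) and let u be a global classical H¹-bounded solution of the b-family equation. Then liminf_{t→∞} ∫_{Λ_{2/3}(t)} ( u(t,x)² + (∂_x u)(t,x)² ) dx = 0, where Λ_{2/3}(t) = (−t^{2/3}/log t, t^{2/3}/log t). -/

import Mathlib

open MeasureTheory Real Filter

/-- Convolution with the Green's function of `1 - d²/dx²` on `ℝ`. -/
noncomputable def G (f : ℝ → ℝ) (x : ℝ) : ℝ :=
  (1 / 2) * ∫ y : ℝ, Real.exp (-|x - y|) * f y

/-- The flux of the nonlocal `b`-family equation at time `t`:
`(1/2)u² + G((b/2)u² + ((3-b)/2)(∂ₓu)²)`. -/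
noncomputable def flux (b : ℝ) (u : ℝ → ℝ → ℝ) (t : ℝ) : ℝ → ℝ :=
  fun y => (1 / 2) * (u t y) ^ 2
    + G (fun z => (b / 2) * (u t z) ^ 2 + ((3 - b) / 2) * (deriv (u t) z) ^ 2) y

/-- `λ_c(t) = t^c / log t`. -/
noncomputable def lam (c t : ℝ) : ℝ := t ^ c / Real.log t

/-- A global classical `H¹`-bounded solution of the nonlocal `b`-family equation:
`C¹` in `t`, `C²` in `x`, jointly continuous partial derivatives, solving the equation
pointwise on `(0,∞) × ℝ`, with `u(t,·), ∂ₓu(t,·) ∈ L²(ℝ)` uniformly bounded in time. -/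
def IsH1BoundedSolution (b : ℝ) (u : ℝ → ℝ → ℝ) : Prop :=
  (∀ x : ℝ, ContDiff ℝ 1 fun t => u t x) ∧
  (∀ t : ℝ, ContDiff ℝ 2 (u t)) ∧
  Continuous (fun p : ℝ × ℝ => u p.1 p.2) ∧
  Continuous (fun p : ℝ × ℝ => deriv (fun s => u s p.2) p.1) ∧
  Continuous (fun p : ℝ × ℝ => deriv (u p.1) p.2) ∧
  Continuous (fun p : ℝ × ℝ => deriv (deriv (u p.1)) p.2) ∧
  (∀ t x : ℝ, 0 < t → deriv (fun s => u s x) t + deriv (flux b u t) x = 0) ∧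
  (∀ t : ℝ, 0 ≤ t → Integrable (fun x => (u t x) ^ 2)
    ∧ Integrable (fun x => (deriv (u t) x) ^ 2)) ∧
  (∃ C : ℝ, ∀ t : ℝ, 0 ≤ t → (∫ x : ℝ, ((u t x) ^ 2 + (deriv (u t) x) ^ 2)) ≤ C)

lemma aux_exp_abs_integral : (∫ x : ℝ, Real.exp (-|x|)) = 2 := by
  rw [integral_comp_abs (f := fun x => Real.exp (-x)), integral_exp_neg_Ioi_zero]; norm_num

lemma aux_exp_abs_integrable : Integrable (fun x : ℝ => Real.exp (-|x|)) := by
  by_contra h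
  have := aux_exp_abs_integral
  rw [integral_undef h] at this
  norm_num at this

lemma aux_exp_le_one (x y : ℝ) : ‖Real.exp (-|x - y|)‖ ≤ 1 := by
  rw [Real.norm_eq_abs, abs_of_pos (Real.exp_pos _), Real.exp_le_one_iff]
  simp

lemma aux_exp_lip (y : ℝ) : LipschitzWith 1 (fun x : ℝ => Real.exp (-|x - y|)) := by
  apply LipschitzWith.of_le_add
  intro a b
  have key : Real.exp (-|a - y|) ≤ Real.exp (-|b - y|) + |a - b| := by
    have h1 : Real.exp (-|a-y|) * (1 + (|a-y| - |b-y|)) ≤ Real.exp (-|b-y|) := by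
      have := Real.add_one_le_exp (|a-y| - |b-y|)
      calc _ ≤ Real.exp (-|a-y|) * Real.exp (|a-y| - |b-y|) := by
            gcongr; linarith
        _ = _ := by rw [← Real.exp_add]; congr 1; ring
    have h2 : Real.exp (-|a-y|) ≤ 1 := by simp
    have h3 := Real.exp_pos (-|a-y|)
    have h4 : |b-y| - |a-y| ≤ |a-b| := by
      have := abs_sub_abs_le_abs_sub (b-y) (a-y)
      rw [show b - y - (a-y) = b-a by ring, abs_sub_comm b a] at this
      exact this
    have h5 : Real.exp (-|a-y|) * (|b-y| - |a-y|) ≤ |a-b| := by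
      calc _ ≤ Real.exp (-|a-y|) * |a-b| := by gcongr
        _ ≤ 1 * |a-b| := by gcongr
        _ = _ := one_mul _
    nlinarith
  simpa [Real.dist_eq] using key

lemma aux_G_diff {f : ℝ → ℝ} (hf : Integrable f) (x : ℝ) : DifferentiableAt ℝ (G f) x := by
  unfold G
  apply DifferentiableAt.const_mul
  have hcont : ∀ z : ℝ, Continuous (fun y : ℝ => Real.exp (-|z - y|)) := fun z => by fun_prop
  refine (hasDerivAt_integral_of_dominated_loc_of_lip (μ := volume) (x₀ := x) (s := Set.univ)
    (F := fun x y => Real.exp (-|x - y|) * f y)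
    (F' := fun y => (Real.exp (-|x - y|) * (-(SignType.sign (x - y) : ℝ))) * f y)
    (bound := f)
    Filter.univ_mem ?_ ?_ ?_ ?_ hf ?_).2.differentiableAt
  · exact Filter.Eventually.of_forall fun z => (hcont z).aestronglyMeasurable.mul hf.1
  · exact hf.bdd_mul (c := 1) (hcont x).aestronglyMeasurable
      (Filter.Eventually.of_forall fun y => aux_exp_le_one x y)
  · refine AEStronglyMeasurable.mul ((hcont x).aestronglyMeasurable.mul ?_) hf.1
    have : Measurable (fun y : ℝ => (SignType.sign (x - y) : ℝ)) := by
      have h0 : Monotone (fun r : ℝ => (SignType.sign r : ℝ)) := by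
        intro a b hab
        have := SignType.sign.monotone hab
        have key : ∀ p q : SignType, p ≤ q → (p : ℝ) ≤ (q : ℝ) := by
          intro p q hpq
          rcases p <;> rcases q <;> first | (revert hpq; decide) | (norm_num)
        exact key _ _ this
      exact h0.measurable.comp (measurable_const.sub measurable_id)
    exact this.neg.aestronglyMeasurable
  · refine Filter.Eventually.of_forall fun y => ?_
    rw [lipschitzOnWith_univ]
    apply LipschitzWith.of_dist_le_mul
    intro a b
    have := (aux_exp_lip y).dist_le_mul a b
    simp only [Real.dist_eq, NNReal.coe_one, one_mul] at this ⊢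
    rw [← sub_mul, abs_mul, mul_comm]
    simp only [Real.coe_nnabs]
    gcongr
  · have : ∀ᵐ y : ℝ, y ≠ x := by simp [ae_iff]
    filter_upwards [this] with y hy
    apply HasDerivAt.mul_const
    have h1 : HasDerivAt (fun z : ℝ => |z - y|) (SignType.sign (x-y) : ℝ) x := by
      have := (hasDerivAt_abs (sub_ne_zero.2 hy.symm)).comp x ((hasDerivAt_id x).sub_const y)
      simpa [Function.comp_def] using this
    exact h1.neg.exp

lemma aux_G_cont {f : ℝ → ℝ} (hf : Integrable f) : Continuous (G f) :=
  continuous_iff_continuousAt.2 fun x => (aux_G_diff hf x).continuousAt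

lemma aux_G_nonneg {f : ℝ → ℝ} (hf : ∀ x, 0 ≤ f x) (x : ℝ) : 0 ≤ G f x := by
  unfold G
  have : 0 ≤ ∫ y : ℝ, Real.exp (-|x - y|) * f y :=
    integral_nonneg fun y => mul_nonneg (Real.exp_pos _).le (hf y)
  positivity

lemma aux_G_int {f : ℝ → ℝ} (hf : Integrable f) {a b : ℝ} (hab : a ≤ b) :
    Integrable (fun y => (∫ x in a..b, Real.exp (-|x - y|)) * f y) ∧
    ∫ x in a..b, G f x = (1/2) * ∫ y, (∫ x in a..b, Real.exp (-|x - y|)) * f y := by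
  have hI : Integrable (fun p : ℝ × ℝ => Real.exp (-|p.1 - p.2|) * f p.2)
      ((volume.restrict (Set.Ioc a b)).prod volume) := by
    apply (hf.comp_snd (volume.restrict (Set.Ioc a b))).bdd_mul (c := 1)
    · exact Continuous.aestronglyMeasurable (by fun_prop)
    · exact Filter.Eventually.of_forall fun p => aux_exp_le_one _ _
  have h1 := hI.integral_prod_right
  simp only [intervalIntegral.integral_of_le hab]
  constructor
  · simpa only [integral_mul_const] using h1
  · unfold G
    rw [integral_const_mul]
    congr 1
    rw [integral_integral_swap hI]
    simp only [integral_mul_const]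

lemma aux_kernel_le {a b : ℝ} (hab : a ≤ b) (y : ℝ) :
    (∫ x in a..b, Real.exp (-|x - y|)) ≤ 2 := by
  rw [intervalIntegral.integral_of_le hab]
  have hI : Integrable (fun x : ℝ => Real.exp (-|x - y|)) := aux_exp_abs_integrable.comp_sub_right y
  calc _ ≤ ∫ x, Real.exp (-|x - y|) :=
        setIntegral_le_integral hI (Filter.Eventually.of_forall fun x => (Real.exp_pos _).le)
    _ = 2 := by rw [integral_sub_right_eq_self (fun x => Real.exp (-|x|)) y]; exact aux_exp_abs_integral

lemma aux_kernel_nonneg {a b : ℝ} (hab : a ≤ b) (y : ℝ) :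
    0 ≤ (∫ x in a..b, Real.exp (-|x - y|)) :=
  intervalIntegral.integral_nonneg hab fun _ _ => (Real.exp_pos _).le

lemma aux_kernel_ge {L : ℝ} (hL : 1/2 ≤ L) {y : ℝ} (hy : y ∈ Set.Ioo (-L) L) :
    1/4 ≤ (∫ x in (-L)..L, Real.exp (-|x - y|)) := by
  obtain ⟨c, h1, h2, h3⟩ : ∃ c, -L ≤ c ∧ c + 1/2 ≤ L ∧ ∀ x ∈ Set.Icc c (c+1/2), |x - y| ≤ 1/2 := by
    rcases le_total y 0 with h | h
    · refine ⟨y, hy.1.le, by linarith, fun x hx => abs_le.2 ⟨?_, ?_⟩⟩ <;> linarith [hx.1, hx.2]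
    · refine ⟨y - 1/2, by linarith, by linarith [hy.2], fun x hx => abs_le.2 ⟨?_, ?_⟩⟩ <;>
        linarith [hx.1, hx.2]
  have hc : Continuous (fun x : ℝ => Real.exp (-|x - y|)) := by fun_prop
  have hle : (∫ x in c..(c+1/2), (1/2 : ℝ)) ≤ ∫ x in c..(c+1/2), Real.exp (-|x - y|) := by
    apply intervalIntegral.integral_mono_on (by linarith) (by simp) (hc.intervalIntegrable _ _)
    intro x hx
    have := Real.add_one_le_exp (-|x-y|)
    linarith [h3 x hx]
  have hle2 : (∫ x in c..(c+1/2), Real.exp (-|x - y|)) ≤ ∫ x in (-L)..L, Real.exp (-|x - y|) :=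
    intervalIntegral.integral_mono_interval h1 (by linarith) h2
      (Filter.Eventually.of_forall fun x => (Real.exp_pos _).le) (hc.intervalIntegrable _ _)
  rw [intervalIntegral.integral_const] at hle
  norm_num at hle
  linarith

lemma aux_G_upper {f : ℝ → ℝ} (hf : Integrable f) (h0 : ∀ x, 0 ≤ f x) {a b : ℝ} (hab : a ≤ b) :
    ∫ x in a..b, G f x ≤ ∫ y, f y := by
  obtain ⟨h1, h2⟩ := aux_G_int hf hab
  rw [h2]
  have : ∫ y, (∫ x in a..b, Real.exp (-|x - y|)) * f y ≤ ∫ y, 2 * f y :=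
    integral_mono h1 (hf.const_mul 2) fun y =>
      mul_le_mul_of_nonneg_right (aux_kernel_le hab y) (h0 y)
  rw [integral_const_mul] at this
  linarith

lemma aux_G_lower {f : ℝ → ℝ} (hf : Integrable f) (h0 : ∀ x, 0 ≤ f x) {L : ℝ} (hL : 1/2 ≤ L) :
    (1/8) * ∫ y in Set.Ioo (-L) L, f y ≤ ∫ x in (-L)..L, G f x := by
  have hab : -L ≤ L := by linarith
  obtain ⟨h1, h2⟩ := aux_G_int hf hab
  rw [h2]
  have h3 : ∫ y in Set.Ioo (-L) L, (1/4) * f y ≤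
      ∫ y in Set.Ioo (-L) L, (∫ x in (-L)..L, Real.exp (-|x - y|)) * f y :=
    setIntegral_mono_on (hf.const_mul _).integrableOn h1.integrableOn measurableSet_Ioo
      fun y hy => mul_le_mul_of_nonneg_right (aux_kernel_ge hL hy) (h0 y)
  have h4 : ∫ y in Set.Ioo (-L) L, (∫ x in (-L)..L, Real.exp (-|x - y|)) * f y ≤
      ∫ y, (∫ x in (-L)..L, Real.exp (-|x - y|)) * f y :=
    setIntegral_le_integral h1 (Filter.Eventually.of_forall fun y =>
      mul_nonneg (aux_kernel_nonneg hab y) (h0 y))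
  rw [integral_const_mul] at h3
  linarith

/-- The nonlocal source density. -/
noncomputable def auxf (b : ℝ) (u : ℝ → ℝ → ℝ) (t z : ℝ) : ℝ :=
  (b / 2) * (u t z) ^ 2 + ((3 - b) / 2) * (deriv (u t) z) ^ 2

lemma aux_flux_eq (b : ℝ) (u : ℝ → ℝ → ℝ) (t : ℝ) :
    flux b u t = fun y => (1 / 2) * (u t y) ^ 2 + G (auxf b u t) y := rfl

lemma auxf_int {b : ℝ} {u : ℝ → ℝ → ℝ} (hu : IsH1BoundedSolution b u) {t : ℝ} (ht : 0 ≤ t) :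
    Integrable (auxf b u t) := by
  obtain ⟨-, -, -, -, -, -, -, hI, -⟩ := hu
  exact ((hI t ht).1.const_mul _).add ((hI t ht).2.const_mul _)

lemma auxf_nonneg {b : ℝ} (hb : b ∈ Set.Ioo (0 : ℝ) 3) (u : ℝ → ℝ → ℝ) (t z : ℝ) :
    0 ≤ auxf b u t z := by
  have h1 := hb.1
  have h2 : 0 < 3 - b := by linarith [hb.2]
  unfold auxf
  positivity

lemma aux_flux_diff {b : ℝ} {u : ℝ → ℝ → ℝ} (hu : IsH1BoundedSolution b u) {t : ℝ} (ht : 0 ≤ t)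
    (x : ℝ) : DifferentiableAt ℝ (flux b u t) x := by
  have hd : Differentiable ℝ (u t) := (hu.2.1 t).differentiable (by norm_num)
  rw [aux_flux_eq]
  exact (((hd x).pow 2).const_mul _).add (aux_G_diff (auxf_int hu ht) x)

lemma aux_flux_cont {b : ℝ} {u : ℝ → ℝ → ℝ} (hu : IsH1BoundedSolution b u) {t : ℝ} (ht : 0 ≤ t) :
    Continuous (flux b u t) :=
  continuous_iff_continuousAt.2 fun x => (aux_flux_diff hu ht x).continuousAt

lemma aux_flux_nonneg {b : ℝ} (hb : b ∈ Set.Ioo (0 : ℝ) 3) (u : ℝ → ℝ → ℝ) (t x : ℝ) :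
    0 ≤ flux b u t x := by
  rw [aux_flux_eq]
  have := aux_G_nonneg (auxf_nonneg hb u t) x
  positivity

lemma aux_ut_cont {b : ℝ} {u : ℝ → ℝ → ℝ} (hu : IsH1BoundedSolution b u) (t : ℝ) :
    Continuous (fun x => deriv (fun s => u s x) t) :=
  hu.2.2.2.1.comp (Continuous.prodMk_right t)

/-- Integration by parts against an affine weight. -/
lemma aux_ibp {b : ℝ} {u : ℝ → ℝ → ℝ} (hu : IsH1BoundedSolution b u) {t : ℝ} (ht : 0 < t)
    (p q α β : ℝ) :
    ∫ x in p..q, (α * x + β) * deriv (fun s => u s x) t =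
      -((α * q + β) * flux b u t q) + (α * p + β) * flux b u t p
        + α * ∫ x in p..q, flux b u t x := by
  have hc := aux_ut_cont hu t
  have hv : ∀ x ∈ Set.uIcc p q, HasDerivAt (flux b u t) (-(deriv (fun s => u s x) t)) x := by
    intro x _
    have h := (aux_flux_diff hu ht.le x).hasDerivAt
    have e := hu.2.2.2.2.2.2.1 t x ht
    rwa [show deriv (flux b u t) x = -(deriv (fun s => u s x) t) by linarith] at h
  have hw : ∀ x ∈ Set.uIcc p q, HasDerivAt (fun x => α * x + β) α x := by
    intro x _
    simpa using ((hasDerivAt_id x).const_mul α).add_const β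
  have := intervalIntegral.integral_mul_deriv_eq_deriv_mul hw hv (by simp)
    (hc.neg.intervalIntegrable _ _)
  simp only [mul_neg, intervalIntegral.integral_neg, intervalIntegral.integral_const_mul] at this
  linarith

/-- Time evolution against an affine weight. -/
lemma aux_time {b : ℝ} {u : ℝ → ℝ → ℝ} (hu : IsH1BoundedSolution b u) {T S : ℝ} (hTS : T ≤ S)
    {p q : ℝ} (hpq : p ≤ q) (α β : ℝ) :
    IntervalIntegrable (fun t => ∫ x in p..q, (α * x + β) * deriv (fun s => u s x) t) volume T S ∧
    ∫ t in T..S, ∫ x in p..q, (α * x + β) * deriv (fun s => u s x) t =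
      ∫ x in p..q, (α * x + β) * (u S x - u T x) := by
  have hct : Continuous (fun z : ℝ × ℝ => (α * z.2 + β) * deriv (fun s => u s z.2) z.1) := by
    have := hu.2.2.2.1
    fun_prop
  constructor
  · apply Continuous.intervalIntegrable
    exact intervalIntegral.continuous_parametric_intervalIntegral_of_continuous' hct p q
  · have hI : Integrable (fun z : ℝ × ℝ => (α * z.2 + β) * deriv (fun s => u s z.2) z.1)
        ((volume.restrict (Set.Ioc T S)).prod (volume.restrict (Set.Ioc p q))) := by
      rw [Measure.prod_restrict]
      exact (hct.continuousOn.integrableOn_compact (isCompact_Icc.prod isCompact_Icc)).mono_set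
        (Set.prod_mono Set.Ioc_subset_Icc_self Set.Ioc_subset_Icc_self)
    have hsw := integral_integral_swap
      (f := fun t x => (α * x + β) * deriv (fun s => u s x) t) hI
    rw [intervalIntegral.integral_of_le hTS, intervalIntegral.integral_of_le hpq]
    simp only [intervalIntegral.integral_of_le hpq]
    rw [hsw]
    congr 1
    ext x
    rw [integral_const_mul, ← intervalIntegral.integral_of_le hTS]
    congr 1
    apply intervalIntegral.integral_deriv_eq_sub
    · intro t _
      exact ((hu.1 x).differentiable (by norm_num)) t
    · exact (hu.2.2.2.1.comp (Continuous.prodMk_left x)).intervalIntegrable _ _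

lemma aux_int_le {b : ℝ} {u : ℝ → ℝ → ℝ} (hu : IsH1BoundedSolution b u) {t C : ℝ} (ht : 0 ≤ t)
    (hC : (∫ x : ℝ, ((u t x) ^ 2 + (deriv (u t) x) ^ 2)) ≤ C) :
    (∫ x, (u t x)^2) ≤ C := by
  obtain ⟨h1, h2⟩ := hu.2.2.2.2.2.2.2.1 t ht
  rw [integral_add h1 h2] at hC
  have : 0 ≤ ∫ x, (deriv (u t) x) ^ 2 := integral_nonneg fun x => sq_nonneg _
  linarith

lemma aux_u_cont {b : ℝ} {u : ℝ → ℝ → ℝ} (hu : IsH1BoundedSolution b u) (t : ℝ) :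
    Continuous (u t) := (hu.2.1 t).continuous

/-- Local L¹ bound. -/
lemma aux_L1 {b : ℝ} {u : ℝ → ℝ → ℝ} (hu : IsH1BoundedSolution b u) {t C : ℝ} (ht : 0 ≤ t)
    (hC : (∫ x : ℝ, ((u t x) ^ 2 + (deriv (u t) x) ^ 2)) ≤ C) {p q : ℝ} (hpq : p ≤ q)
    {d : ℝ} (hd : 0 < d) :
    ∫ x in p..q, |u t x| ≤ ((q - p) / d + d * C) / 2 := by
  have hc := aux_u_cont hu t
  have h1 : ∫ x in p..q, |u t x| ≤ ∫ x in p..q, (1 / d / 2 + (d / 2) * (u t x)^2) := by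
    apply intervalIntegral.integral_mono_on hpq (Continuous.intervalIntegrable (by fun_prop) _ _)
      (Continuous.intervalIntegrable (by fun_prop) _ _)
    intro x _
    rw [← sq_abs]
    have h : 0 ≤ (d * |u t x| - 1)^2 / (2 * d) := by positivity
    have e : (d * |u t x| - 1)^2 / (2 * d) = 1 / d / 2 + (d / 2) * |u t x|^2 - |u t x| := by
      field_simp; ring
    linarith
  rw [intervalIntegral.integral_add (by simp) (Continuous.intervalIntegrable (by fun_prop) _ _),
    intervalIntegral.integral_const, intervalIntegral.integral_const_mul] at h1
  have h2 : ∫ x in p..q, (u t x)^2 ≤ C := by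
    rw [intervalIntegral.integral_of_le hpq]
    exact (setIntegral_le_integral (hu.2.2.2.2.2.2.2.1 t ht).1
      (Filter.Eventually.of_forall fun x => sq_nonneg _)).trans (aux_int_le hu ht hC)
  have h3 : d / 2 * ∫ x in p..q, (u t x)^2 ≤ d / 2 * C := by gcongr
  simp only [smul_eq_mul] at h1
  have e : (q - p) * (1 / d / 2) = (q - p) / d / 2 := by ring
  linarith

/-- Bound of the weighted increment. -/
lemma aux_J {b : ℝ} {u : ℝ → ℝ → ℝ} (hu : IsH1BoundedSolution b u) {T S C : ℝ} (hT : 0 ≤ T)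
    (hS : 0 ≤ S) (hC : ∀ t, 0 ≤ t → (∫ x : ℝ, ((u t x) ^ 2 + (deriv (u t) x) ^ 2)) ≤ C)
    {p q : ℝ} (hpq : p ≤ q) {d : ℝ} (hd : 0 < d) {α β : ℝ}
    (hw : ∀ x ∈ Set.Icc p q, |α * x + β| ≤ 1) :
    ∫ x in p..q, (α * x + β) * (u S x - u T x) ≤ (q - p) / d + d * C := by
  have hcS := aux_u_cont hu S
  have hcT := aux_u_cont hu T
  have h1 : ∫ x in p..q, (α * x + β) * (u S x - u T x) ≤ ∫ x in p..q, (|u S x| + |u T x|) := by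
    apply intervalIntegral.integral_mono_on hpq (Continuous.intervalIntegrable (by fun_prop) _ _)
      (Continuous.intervalIntegrable (by fun_prop) _ _)
    intro x hx
    calc _ ≤ |(α * x + β) * (u S x - u T x)| := le_abs_self _
      _ = |α * x + β| * |u S x - u T x| := abs_mul _ _
      _ ≤ 1 * |u S x - u T x| := by gcongr; exact hw x hx
      _ ≤ _ := by rw [one_mul]; exact abs_sub _ _
  rw [intervalIntegral.integral_add (Continuous.intervalIntegrable (by fun_prop) _ _)
    (Continuous.intervalIntegrable (by fun_prop) _ _)] at h1
  linarith [aux_L1 hu hS (hC S hS) hpq hd, aux_L1 hu hT (hC T hT) hpq hd]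

lemma aux_flux_upper {b : ℝ} (hb : b ∈ Set.Ioo (0 : ℝ) 3) {u : ℝ → ℝ → ℝ}
    (hu : IsH1BoundedSolution b u) {t C : ℝ} (ht : 0 ≤ t)
    (hC : (∫ x : ℝ, ((u t x) ^ 2 + (deriv (u t) x) ^ 2)) ≤ C) {p q : ℝ} (hpq : p ≤ q) :
    ∫ x in p..q, flux b u t x ≤ 2 * C := by
  have hc := aux_u_cont hu t
  have hf := auxf_int hu ht
  obtain ⟨hb0, hb3⟩ := hb
  obtain ⟨i1, i2⟩ := hu.2.2.2.2.2.2.2.1 t ht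
  rw [aux_flux_eq, intervalIntegral.integral_add (Continuous.intervalIntegrable (by fun_prop) _ _)
    ((aux_G_cont hf).intervalIntegrable _ _), intervalIntegral.integral_const_mul]
  have h2 : ∫ x in p..q, (u t x)^2 ≤ C := by
    rw [intervalIntegral.integral_of_le hpq]
    exact (setIntegral_le_integral i1
      (Filter.Eventually.of_forall fun x => sq_nonneg _)).trans (aux_int_le hu ht hC)
  have h3 := aux_G_upper hf (auxf_nonneg ⟨hb0, hb3⟩ u t) hpq
  have h4 : ∫ y, auxf b u t y ≤ ∫ y, (3/2) * ((u t y) ^ 2 + (deriv (u t) y) ^ 2) := by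
    apply integral_mono hf ((i1.add i2).const_mul _)
    intro y
    simp only [auxf, Pi.add_apply]
    nlinarith [sq_nonneg (u t y), sq_nonneg (deriv (u t) y)]
  rw [integral_const_mul] at h4
  linarith

lemma aux_flux_lower {b : ℝ} (hb : b ∈ Set.Ioo (0 : ℝ) 3) {u : ℝ → ℝ → ℝ}
    (hu : IsH1BoundedSolution b u) {t : ℝ} (ht : 0 ≤ t) {L : ℝ} (hL : 1/2 ≤ L) :
    (min b (3 - b) / 16) * (∫ x in Set.Ioo (-L) L, ((u t x) ^ 2 + (deriv (u t) x) ^ 2)) ≤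
      ∫ x in (-L)..L, flux b u t x := by
  have hc := aux_u_cont hu t
  have hf := auxf_int hu ht
  obtain ⟨i1, i2⟩ := hu.2.2.2.2.2.2.2.1 t ht
  have h3 := aux_G_lower hf (auxf_nonneg hb u t) hL
  have h4 : ∫ y in Set.Ioo (-L) L, (min b (3-b) / 2) * ((u t y) ^ 2 + (deriv (u t) y) ^ 2) ≤
      ∫ y in Set.Ioo (-L) L, auxf b u t y := by
    apply setIntegral_mono ((i1.add i2).const_mul _).integrableOn hf.integrableOn
    intro y
    simp only [auxf, Pi.add_apply]
    nlinarith [sq_nonneg (u t y), sq_nonneg (deriv (u t) y), min_le_left b (3-b),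
      min_le_right b (3-b)]
  rw [integral_const_mul] at h4
  have h5 : ∫ x in (-L)..L, G (auxf b u t) x ≤ ∫ x in (-L)..L, flux b u t x := by
    apply intervalIntegral.integral_mono_on (by linarith)
      ((aux_G_cont hf).intervalIntegrable _ _) ((aux_flux_cont hu ht).intervalIntegrable _ _)
    intro x _
    rw [aux_flux_eq]
    have := sq_nonneg (u t x)
    simp only
    linarith
  linarith

/-- The key inequality on `[T, 2T]`. -/
lemma aux_key {b : ℝ} (hb : b ∈ Set.Ioo (0 : ℝ) 3) {u : ℝ → ℝ → ℝ}
    (hu : IsH1BoundedSolution b u) {T C e L M d : ℝ} (hT : 0 < T) (hL : 1/2 ≤ L) (hM : 0 < M)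
    (hd : 0 < d)
    (hC : ∀ t, 0 ≤ t → (∫ x : ℝ, ((u t x) ^ 2 + (deriv (u t) x) ^ 2)) ≤ C)
    (he : ∀ t ∈ Set.Icc T (2 * T),
      e ≤ ∫ x in Set.Ioo (-L) L, ((u t x) ^ 2 + (deriv (u t) x) ^ 2)) :
    T * ((min b (3 - b) / 16) * e / L - 4 * C / M) ≤ (2 * L + 2 * M) / d + 3 * d * C := by
  have hL0 : 0 < L := by linarith
  have hTS : T ≤ 2 * T := by linarith
  have hm : 0 < min b (3 - b) := lt_min hb.1 (by linarith [hb.2])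
  obtain ⟨I1, E1⟩ := aux_time hu hTS (show -(L+M) ≤ -L by linarith) (-(1/M)) (-((L+M)/M))
  obtain ⟨I2, E2⟩ := aux_time hu hTS (show -L ≤ L by linarith) (1/L) 0
  obtain ⟨I3, E3⟩ := aux_time hu hTS (show L ≤ L + M by linarith) (-(1/M)) ((L+M)/M)
  have J1 := aux_J hu hT.le (by linarith : 0 ≤ 2 * T) hC (show -(L+M) ≤ -L by linarith) hd
    (α := -(1/M)) (β := -((L+M)/M)) (by
      intro x hx
      rw [show -(1/M) * x + -((L+M)/M) = -((x + L + M)/M) by ring, abs_neg, abs_div, abs_of_pos hM,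
        div_le_one hM, abs_le]
      constructor <;> linarith [hx.1, hx.2])
  have J2 := aux_J hu hT.le (by linarith : 0 ≤ 2 * T) hC (show -L ≤ L by linarith) hd
    (α := 1/L) (β := 0) (by
      intro x hx
      rw [show 1/L * x + 0 = x / L by ring, abs_div, abs_of_pos hL0, div_le_one hL0, abs_le]
      exact hx)
  have J3 := aux_J hu hT.le (by linarith : 0 ≤ 2 * T) hC (show L ≤ L + M by linarith) hd
    (α := -(1/M)) (β := ((L+M)/M)) (by
      intro x hx
      rw [show -(1/M) * x + ((L+M)/M) = (L + M - x)/M by ring, abs_div, abs_of_pos hM,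
        div_le_one hM, abs_le]
      constructor <;> linarith [hx.1, hx.2])
  rw [← E1] at J1
  rw [← E2] at J2
  rw [← E3] at J3
  have hlow : ∫ t in T..(2*T), ((min b (3 - b) / 16) * e / L - 4 * C / M) ≤
      ∫ t in T..(2*T), (((∫ x in (-(L+M))..(-L), (-(1/M) * x + -((L+M)/M)) * deriv (fun s => u s x) t)
        + ∫ x in (-L)..L, (1/L * x + 0) * deriv (fun s => u s x) t)
        + ∫ x in L..(L+M), (-(1/M) * x + (L+M)/M) * deriv (fun s => u s x) t) := by
    apply intervalIntegral.integral_mono_on hTS (by simp) ((I1.add I2).add I3)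
    intro t ht
    have ht0 : 0 < t := by linarith [ht.1]
    rw [aux_ibp hu ht0, aux_ibp hu ht0, aux_ibp hu ht0]
    have U1 := aux_flux_upper hb hu ht0.le (hC t ht0.le) (show -(L+M) ≤ -L by linarith)
    have U3 := aux_flux_upper hb hu ht0.le (hC t ht0.le) (show L ≤ L + M by linarith)
    have U2 := aux_flux_lower hb hu ht0.le hL
    have h2 : (min b (3 - b) / 16) * e ≤ ∫ x in (-L)..L, flux b u t x := by
      refine le_trans ?_ U2
      gcongr
      exact he t ht
    have h2' : (min b (3 - b) / 16) * e / L ≤ 1 / L * ∫ x in (-L)..L, flux b u t x := by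
      rw [one_div, inv_mul_eq_div]; gcongr
    have h1' : 1 / M * (∫ x in (-(L+M))..(-L), flux b u t x) ≤ 1 / M * (2 * C) := by gcongr
    have h3' : 1 / M * (∫ x in L..(L+M), flux b u t x) ≤ 1 / M * (2 * C) := by gcongr
    have e1 : -(1/M) * (-L) + -((L+M)/M) = -1 := by field_simp; ring
    have e2 : -(1/M) * (-(L+M)) + -((L+M)/M) = 0 := by field_simp; ring
    have e3 : 1/L * L + 0 = 1 := by field_simp; ring
    have e4 : 1/L * (-L) + 0 = -1 := by field_simp; ring
    have e5 : -(1/M) * L + (L+M)/M = 1 := by field_simp; ring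
    have e6 : -(1/M) * (L+M) + (L+M)/M = 0 := by field_simp; ring
    rw [e1, e2, e3, e4, e5, e6]
    have e7 : 4 * C / M = 1 / M * (2 * C) + 1 / M * (2 * C) := by ring
    rw [e7]
    linarith
  rw [intervalIntegral.integral_add (I1.add I2) I3, intervalIntegral.integral_add I1 I2,
    intervalIntegral.integral_const, smul_eq_mul] at hlow
  have e8 : (2 * L + 2 * M) / d = (-L - -(L+M)) / d + (L - -L) / d + (L + M - L) / d := by ring
  rw [e8]
  have e9 : 2 * T - T = T := by ring
  rw [e9] at hlow
  linarith

/-- For a global classical `H¹`-bounded solution of the `b`-family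
equation, `liminf_{t→∞} ∫_{Λ_{2/3}(t)} (u² + (∂ₓu)²) dx = 0`, where
`Λ_{2/3}(t) = (-t^{2/3}/log t, t^{2/3}/log t)`. -/
theorem local_energy_liminf_two_thirds (b : ℝ) (hb : b ∈ Set.Ioo (0 : ℝ) 3)
    (u : ℝ → ℝ → ℝ) (hu : IsH1BoundedSolution b u) :
    Filter.liminf
      (fun t : ℝ =>
        ∫ x in Set.Ioo (-(lam (2 / 3) t)) (lam (2 / 3) t),
          ((u t x) ^ 2 + (deriv (u t) x) ^ 2))
      Filter.atTop = 0 := by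
  obtain ⟨C, hC⟩ := hu.2.2.2.2.2.2.2.2
  have hInt : ∀ t, 0 ≤ t → Integrable (fun x => (u t x) ^ 2 + (deriv (u t) x) ^ 2) := fun t ht =>
    (hu.2.2.2.2.2.2.2.1 t ht).1.add (hu.2.2.2.2.2.2.2.1 t ht).2
  have hpos : ∀ t x, 0 ≤ (u t x) ^ 2 + (deriv (u t) x) ^ 2 := fun t x => by positivity
  have hC0 : 0 ≤ C := (integral_nonneg (hpos 0)).trans (hC 0 le_rfl)
  set E : ℝ → ℝ := fun t => ∫ x in Set.Ioo (-(lam (2 / 3) t)) (lam (2 / 3) t),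
          ((u t x) ^ 2 + (deriv (u t) x) ^ 2) with hE
  have hE0 : ∀ t, 0 ≤ E t := fun t => integral_nonneg (hpos t)
  have hEC : ∀ t, 0 ≤ t → E t ≤ C := fun t ht =>
    (setIntegral_le_integral (hInt t ht) (Filter.Eventually.of_forall (hpos t))).trans (hC t ht)
  have hbdd : Filter.IsBoundedUnder (· ≥ ·) Filter.atTop E :=
    Filter.isBoundedUnder_of_eventually_ge (Filter.Eventually.of_forall hE0)
  have hcob : Filter.IsCoboundedUnder (· ≥ ·) Filter.atTop E :=
    (Filter.isBoundedUnder_of_eventually_le (a := C)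
      ((Filter.eventually_ge_atTop 0).mono hEC)).isCoboundedUnder_ge
  apply le_antisymm _ (Filter.le_liminf_of_le hcob (Filter.Eventually.of_forall hE0))
  by_contra hcon
  push Not at hcon
  obtain ⟨e, he0, he1⟩ := exists_between hcon
  obtain ⟨T0, hT0⟩ := Filter.eventually_atTop.1 (Filter.eventually_lt_of_lt_liminf he1 hbdd)
  have hm : 0 < min b (3 - b) := lt_min hb.1 (by linarith [hb.2])
  set κ := min b (3 - b) / 16 * e with hκ
  have hκ0 : 0 < κ := by positivity
  set K := 8 * C / κ + 1 with hK
  have hK0 : 0 < K := by positivity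
  set D := 2 + 2 * K + 3 * C with hD
  have hD0 : 0 < D := by positivity
  obtain ⟨T, hTT0, hT1, hlogD, hlog1⟩ : ∃ T, T0 ≤ T ∧ 1 ≤ T ∧ 16 * D^2 / κ^2 < Real.log T ∧
      1 ≤ Real.log T :=
    ((Filter.eventually_ge_atTop T0).and ((Filter.eventually_ge_atTop 1).and
      ((Real.tendsto_log_atTop.eventually_gt_atTop _).and
        (Real.tendsto_log_atTop.eventually_ge_atTop 1)))).exists
  have hT : 0 < T := by linarith
  have hlog0 : 0 < Real.log T := by linarith
  set L := (2 * T) ^ (2/3 : ℝ) / Real.log T with hLdef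
  have hL3 : L ^ 3 * (Real.log T)^3 = 4 * T^2 := by
    rw [hLdef, div_pow, div_mul_cancel₀ _ (by positivity), ← Real.rpow_natCast,
      ← Real.rpow_mul (by positivity)]
    norm_num
    ring
  have hL : 1/2 ≤ L := by
    rw [hLdef, le_div_iff₀ hlog0]
    have h1 := Real.log_le_rpow_div hT.le (show (0:ℝ) < 2/3 by norm_num)
    have h2 : T ^ (2/3 : ℝ) ≤ (2 * T) ^ (2/3 : ℝ) := by gcongr; linarith
    have h3 : 0 < T ^ (2/3 : ℝ) := by positivity
    have h4 : T ^ (2/3 : ℝ) / (2/3) = (3/2) * T ^ (2/3 : ℝ) := by ring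
    linarith
  have hL0 : 0 < L := by linarith
  have hkey := aux_key hb hu (T := T) (C := C) (e := e) (L := L) (M := K * L) (d := √L) hT hL
    (by positivity) (by positivity) hC (by
      intro t ht
      have ht0 : 0 < t := by linarith [ht.1]
      have hlam : lam (2/3) t ≤ L := by
        unfold lam
        rw [hLdef]
        have := Real.log_le_log hT ht.1
        gcongr
        exact ht.2
      refine (hT0 t (hTT0.trans ht.1)).le.trans ?_
      exact setIntegral_mono_set (hInt t ht0.le).integrableOn
        (Filter.Eventually.of_forall (hpos t))
        (Set.Ioo_subset_Ioo (by linarith) hlam).eventuallyLE)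
  rw [← hκ] at hkey
  have hs : √L * √L = L := Real.mul_self_sqrt hL0.le
  have hs0 : 0 < √L := Real.sqrt_pos.2 hL0
  have r1 : (2 * L + 2 * (K * L)) / √L + 3 * √L * C = D * √L := by
    rw [div_add' _ _ _ hs0.ne', div_eq_iff hs0.ne', hD]
    linear_combination (-2 - 2 * K) * hs
  have r2 : κ / 2 / L ≤ κ / L - 4 * C / (K * L) := by
    have : 4 * C / K ≤ κ / 2 := by
      rw [div_le_iff₀ hK0, hK]
      have : κ / 2 * (8 * C / κ + 1) = 4 * C + κ / 2 := by field_simp; ring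
      linarith
    have h2 : κ / L - 4 * C / (K * L) = (κ - 4 * C / K) / L := by field_simp
    rw [h2]
    gcongr
    linarith
  rw [r1] at hkey
  have r3 : T * (κ / 2) ≤ D * √L * L := by
    have : T * (κ / 2 / L) ≤ D * √L := le_trans (by gcongr) hkey
    rw [← mul_div_assoc, div_le_iff₀ hL0] at this
    exact this
  have r4 : (T * (κ / 2))^2 ≤ D^2 * L^3 := by
    calc _ ≤ (D * √L * L)^2 := by gcongr
      _ = D^2 * (√L * √L) * L^2 := by ring
      _ = _ := by rw [hs]; ring
  have r5 : T^2 * (κ^2 * (Real.log T)^3) ≤ T^2 * (16 * D^2) := by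
    have : (T * (κ / 2))^2 * (Real.log T)^3 ≤ D^2 * L^3 * (Real.log T)^3 := by gcongr
    nlinarith
  have r6 := le_of_mul_le_mul_left r5 (by positivity)
  rw [div_lt_iff₀ (by positivity)] at hlogD
  have r7 : Real.log T ≤ (Real.log T)^3 := le_self_pow₀ hlog1 (by norm_num)
  have r8 : Real.log T * κ^2 ≤ (Real.log T)^3 * κ^2 := by gcongr
  linarith
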